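/- Let Ω be a nonempty set of symmetric positive semidefinite d×d real matrices each satisfying ‖Λ‖_op ≤ 1, and set γ_Φ² := max_{φ∈Φ} ‖φ‖₂², assumed strictly positive. If η ≥ 2·(1 + ‖Λ₀‖_op)·log|Φ| / γ_Φ², then inf_{Λ∈Ω} f(Λ) ≤ 2 · inf_{Λ∈Ω} max_{φ∈Φ} φᵀ A(Λ)⁻¹ φ. -/

import Mathlib

open Matrix

/-- The ℓ₂→ℓ₂ operator norm of a square real matrix. -/
noncomputable def opNorm {d : ℕ} (M : Matrix (Fin d) (Fin d) ℝ) : ℝ :=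
  ‖Matrix.toEuclideanCLM (𝕜 := ℝ) M‖

/-- The smoothed XY-experiment-design objective. -/
noncomputable def smoothedXY {d : ℕ} (Φ : Finset (Fin d → ℝ))
    (Λ₀ : Matrix (Fin d) (Fin d) ℝ) (η : ℝ) (Λ : Matrix (Fin d) (Fin d) ℝ) : ℝ :=
  (1 / η) * Real.log (∑ φ ∈ Φ, Real.exp (η * (φ ⬝ᵥ (Λ + Λ₀)⁻¹ *ᵥ φ)))

/-- The quadratic form of a matrix is bounded by its operator norm. -/
theorem dotProduct_mulVec_le_opNorm {d : ℕ} (M : Matrix (Fin d) (Fin d) ℝ) (v : Fin d → ℝ) :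
    v ⬝ᵥ M *ᵥ v ≤ opNorm M * (v ⬝ᵥ v) := by
  have hinner : v ⬝ᵥ M *ᵥ v =
      inner ℝ (WithLp.toLp 2 v) (Matrix.toEuclideanCLM (𝕜 := ℝ) M (WithLp.toLp 2 v)) := by
    simp [EuclideanSpace.inner_eq_star_dotProduct, dotProduct_comm]
  have hnorm : v ⬝ᵥ v = ‖WithLp.toLp 2 v‖ * ‖WithLp.toLp 2 v‖ := by
    rw [← real_inner_self_eq_norm_mul_norm, EuclideanSpace.inner_eq_star_dotProduct, star_trivial]
  rw [hinner, hnorm, ← mul_assoc, mul_comm]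
  calc _ ≤ ‖WithLp.toLp 2 v‖ * ‖Matrix.toEuclideanCLM (𝕜 := ℝ) M (WithLp.toLp 2 v)‖ :=
        real_inner_le_norm _ _
    _ ≤ ‖WithLp.toLp 2 v‖ * (opNorm M * ‖WithLp.toLp 2 v‖) := by
        gcongr
        exact ContinuousLinearMap.le_opNorm _ _
    _ = _ := by ring

theorem opNorm_nonneg {d : ℕ} (M : Matrix (Fin d) (Fin d) ℝ) : 0 ≤ opNorm M :=
  norm_nonneg _

theorem opNorm_add_le {d : ℕ} (M N : Matrix (Fin d) (Fin d) ℝ) :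
    opNorm (M + N) ≤ opNorm M + opNorm N := by
  unfold opNorm
  rw [map_add]
  exact norm_add_le _ _

/-- The inverse of a positive definite matrix of operator norm at most `c` dominates `c⁻¹`. -/
theorem Matrix.PosDef.div_le_dotProduct_inv_mulVec {d : ℕ} {A : Matrix (Fin d) (Fin d) ℝ}
    (hA : A.PosDef) {c : ℝ} (hc : 0 < c) (hAc : opNorm A ≤ c) (v : Fin d → ℝ) :
    v ⬝ᵥ v / c ≤ v ⬝ᵥ A⁻¹ *ᵥ v := by
  have hvv : 0 ≤ v ⬝ᵥ v := by simpa using dotProduct_star_self_nonneg v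
  have hquad : v ⬝ᵥ A *ᵥ v ≤ c * (v ⬝ᵥ v) :=
    (dotProduct_mulVec_le_opNorm A v).trans (by gcongr)
  have hinv : A *ᵥ (A⁻¹ *ᵥ v) = v := by
    rw [mulVec_mulVec, mul_nonsing_inv _ ((isUnit_iff_isUnit_det _).1 hA.isUnit), one_mulVec]
  have hsymm : (A⁻¹ *ᵥ v) ⬝ᵥ A *ᵥ v = v ⬝ᵥ v := by
    have hT : Aᵀ = A := by simpa using hA.isHermitian.eq
    rw [dotProduct_mulVec, ← mulVec_transpose, hT, hinv]
  have hnonneg := hA.posSemidef.dotProduct_mulVec_nonneg (A⁻¹ *ᵥ v - c⁻¹ • v)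
  simp only [star_trivial, mulVec_sub, mulVec_smul, hinv, dotProduct_sub, sub_dotProduct,
    dotProduct_smul, smul_dotProduct, hsymm, smul_eq_mul,
    dotProduct_comm (A⁻¹ *ᵥ v) v] at hnonneg
  have hscaled : c⁻¹ * (c⁻¹ * (v ⬝ᵥ A *ᵥ v)) ≤ c⁻¹ * (v ⬝ᵥ v) := by
    gcongr
    rwa [inv_mul_le_iff₀ hc]
  rw [div_eq_inv_mul]
  linarith

/-- The log-sum-exp smoothing exceeds the maximum by at most `log |Φ| / η`. -/
theorem smoothedXY_le_of_forall_le {d : ℕ} {Φ : Finset (Fin d → ℝ)} (hΦ : Φ.Nonempty)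
    {Λ₀ Λ : Matrix (Fin d) (Fin d) ℝ} {η m : ℝ} (hη : 0 < η)
    (hm : ∀ φ ∈ Φ, φ ⬝ᵥ (Λ + Λ₀)⁻¹ *ᵥ φ ≤ m) :
    smoothedXY Φ Λ₀ η Λ ≤ m + Real.log Φ.card / η := by
  have hsum : ∑ φ ∈ Φ, Real.exp (η * (φ ⬝ᵥ (Λ + Λ₀)⁻¹ *ᵥ φ)) ≤ Φ.card * Real.exp (η * m) := by
    rw [← nsmul_eq_mul]
    refine Finset.sum_le_card_nsmul _ _ _ fun φ hφ => ?_
    have := hm φ hφ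
    gcongr
  have hlog := Real.log_le_log (Finset.sum_pos (fun φ _ => Real.exp_pos _) hΦ) hsum
  rw [Real.log_mul (by simpa using hΦ.ne_empty) (Real.exp_ne_zero _), Real.log_exp] at hlog
  calc smoothedXY Φ Λ₀ η Λ ≤ 1 / η * (Real.log Φ.card + η * m) := by
        unfold smoothedXY
        gcongr
    _ = m + Real.log Φ.card / η := by field_simp; ring

theorem smoothedXY_nonneg {d : ℕ} {Φ : Finset (Fin d → ℝ)} (hΦ : Φ.Nonempty)
    {Λ₀ Λ : Matrix (Fin d) (Fin d) ℝ} {η : ℝ} (hη : 0 < η) (hA : (Λ + Λ₀).PosDef) :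
    0 ≤ smoothedXY Φ Λ₀ η Λ := by
  refine mul_nonneg (by positivity) (Real.log_nonneg ?_)
  obtain ⟨φ, hφ⟩ := hΦ
  have hq : 0 ≤ φ ⬝ᵥ (Λ + Λ₀)⁻¹ *ᵥ φ := by
    simpa using hA.inv.posSemidef.dotProduct_mulVec_nonneg φ
  exact (Real.one_le_exp (mul_nonneg hη.le hq)).trans
    (Finset.single_le_sum (f := fun φ => Real.exp (η * (φ ⬝ᵥ (Λ + Λ₀)⁻¹ *ᵥ φ)))
      (fun _ _ => (Real.exp_pos _).le) hφ)

/-- **The optimal value of the smoothed XY-design is within a factor 2 of the optimal value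
of the (unsmoothed) XY-design.** -/
theorem smoothedXY_inf_le_two_inf
    (d : ℕ) (hd : 0 < d)
    (Φ : Finset (Fin d → ℝ)) (hΦ : Φ.Nonempty)
    (Λ₀ : Matrix (Fin d) (Fin d) ℝ) (hΛ₀ : Λ₀.PosDef)
    (Ω : Set (Matrix (Fin d) (Fin d) ℝ)) (hΩne : Ω.Nonempty)
    (hΩ : ∀ Λ ∈ Ω, Λ.PosSemidef ∧ opNorm Λ ≤ 1)
    (hγ : 0 < Φ.sup' hΦ (fun φ => φ ⬝ᵥ φ))
    (η : ℝ) (hη0 : 0 < η)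
    (hη : η ≥ 2 * (1 + opNorm Λ₀) * Real.log (Φ.card) / Φ.sup' hΦ (fun φ => φ ⬝ᵥ φ)) :
    sInf ((fun Λ => smoothedXY Φ Λ₀ η Λ) '' Ω) ≤
      2 * sInf ((fun Λ => Φ.sup' hΦ (fun φ => φ ⬝ᵥ (Λ + Λ₀)⁻¹ *ᵥ φ)) '' Ω) := by
  have hA : ∀ Λ ∈ Ω, (Λ + Λ₀).PosDef := fun Λ hΛ => hΛ₀.posSemidef_add (hΩ Λ hΛ).1
  suffices h : ∀ Λ ∈ Ω, sInf ((fun Λ => smoothedXY Φ Λ₀ η Λ) '' Ω) / 2 ≤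
      Φ.sup' hΦ (fun φ => φ ⬝ᵥ (Λ + Λ₀)⁻¹ *ᵥ φ) by
    have := le_csInf (hΩne.image _) (Set.forall_mem_image.2 h)
    linarith
  intro Λ hΛ
  have hc : 0 < 1 + opNorm Λ₀ := by linarith [opNorm_nonneg Λ₀]
  have hopNorm : opNorm (Λ + Λ₀) ≤ 1 + opNorm Λ₀ :=
    (opNorm_add_le _ _).trans (by linarith [(hΩ Λ hΛ).2])
  set γ := Φ.sup' hΦ (fun φ => φ ⬝ᵥ φ)
  set m := Φ.sup' hΦ (fun φ => φ ⬝ᵥ (Λ + Λ₀)⁻¹ *ᵥ φ)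
  have hle : ∀ φ ∈ Φ, φ ⬝ᵥ (Λ + Λ₀)⁻¹ *ᵥ φ ≤ m := fun φ hφ =>
    Finset.le_sup' (fun φ => φ ⬝ᵥ (Λ + Λ₀)⁻¹ *ᵥ φ) hφ
  have hγm : γ ≤ m * (1 + opNorm Λ₀) := Finset.sup'_le hΦ _ fun φ hφ =>
    (div_le_iff₀ hc).1
      (((hA Λ hΛ).div_le_dotProduct_inv_mulVec hc hopNorm φ).trans (hle φ hφ))
  have hm : 0 < m := pos_of_mul_pos_left (hγ.trans_le hγm) hc.le
  have hlog : Real.log Φ.card / η ≤ m := by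
    rw [ge_iff_le, div_le_iff₀ hγ] at hη
    rw [div_le_iff₀ hη0]
    have := mul_le_mul_of_nonneg_left hγm hη0.le
    have : (1 + opNorm Λ₀) * (2 * Real.log Φ.card) ≤ (1 + opNorm Λ₀) * (m * η) := by linarith
    have := le_of_mul_le_mul_left this hc
    have := mul_pos hm hη0
    linarith
  have hbdd : BddBelow ((fun Λ => smoothedXY Φ Λ₀ η Λ) '' Ω) :=
    ⟨0, Set.forall_mem_image.2 fun Λ hΛ => smoothedXY_nonneg hΦ hη0 (hA Λ hΛ)⟩
  have hInf := csInf_le hbdd (Set.mem_image_of_mem _ hΛ)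
  have := smoothedXY_le_of_forall_le hΦ hη0 hle
  linarith
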